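/- Let n ≥ 2 be an integer and ξ a transcendental real number. Assume that every sufficiently large integer k is good for (n, ξ). Then ŵ_n(ξ) ≤ ρ_n := max{((√5+1)/2)·n − (√5−1)/2, 2n−2}; in particular ŵ_n(ξ) ≤ 2n−2 whenever n ≥ 4, ŵ_3(ξ) ≤ 2+√5, and ŵ_2(ξ) ≤ (3+√5)/2. -/

import Mathlib

open Polynomial Filter

noncomputable section

/-- Height of an integer polynomial: maximum absolute value of its coefficients. -/
def polyHeight (P : Polynomial ℤ) : ℕ :=
  P.support.sup fun i => (P.coeff i).natAbs

/-- The set of exponents `w` admissible for the uniform exponent `ŵ_n(ξ)`. -/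
def uniformExpSet (n : ℕ) (ξ : ℝ) : Set ℝ :=
  {w | ∀ᶠ X : ℝ in atTop, ∃ P : Polynomial ℤ, P.natDegree ≤ n ∧
    (polyHeight P : ℝ) ≤ X ∧ 0 < |Polynomial.aeval ξ P| ∧
    |Polynomial.aeval ξ P| < X ^ (-w)}

/-- The uniform exponent `ŵ_n(ξ)`, as an extended real. -/
def wHat (n : ℕ) (ξ : ℝ) : EReal :=
  sSup ((fun w : ℝ => (w : EReal)) '' uniformExpSet n ξ)

/-- The set of exponents `w` admissible for the ordinary exponent `w_n(ξ)`. -/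
def ordExpSet (n : ℕ) (ξ : ℝ) : Set ℝ :=
  {w | {P : Polynomial ℤ | P.natDegree ≤ n ∧ 0 < |Polynomial.aeval ξ P| ∧
      |Polynomial.aeval ξ P| < (polyHeight P : ℝ) ^ (-w)}.Infinite}

/-- The ordinary exponent `w_n(ξ)`, as an extended real. -/
def wOrd (n : ℕ) (ξ : ℝ) : EReal :=
  sSup ((fun w : ℝ => (w : EReal)) '' ordExpSet n ξ)

/-- `P` (1-indexed: the relevant values are `P 1, P 2, …`) is the sequence of best
approximation polynomials associated to `(n, ξ)`. -/
structure IsBestApproxSeq (n : ℕ) (ξ : ℝ) (P : ℕ → Polynomial ℤ) : Prop where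
  ne_zero : ∀ k, 1 ≤ k → P k ≠ 0
  deg_le : ∀ k, 1 ≤ k → (P k).natDegree ≤ n
  height_lt : ∀ k, 1 ≤ k → polyHeight (P k) < polyHeight (P (k+1))
  eval_lt : ∀ k, 1 ≤ k → |Polynomial.aeval ξ (P (k+1))| < |Polynomial.aeval ξ (P k)|
  isMin : ∀ k, 1 ≤ k → ∀ Q : Polynomial ℤ, Q ≠ 0 → Q.natDegree ≤ n →
    polyHeight Q ≤ polyHeight (P k) →
    |Polynomial.aeval ξ (P k)| ≤ |Polynomial.aeval ξ Q|
  complete : ∀ Q : Polynomial ℤ, Q ≠ 0 → Q.natDegree ≤ n →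
    (∀ R : Polynomial ℤ, R ≠ 0 → R.natDegree ≤ n → polyHeight R ≤ polyHeight Q →
      |Polynomial.aeval ξ Q| ≤ |Polynomial.aeval ξ R|) →
    ∃ k, 1 ≤ k ∧ (Q = P k ∨ Q = -P k)

/-- The image of an integer polynomial in `ℚ[X]`. -/
def ratPoly (P : Polynomial ℤ) : Polynomial ℚ := P.map (Int.castRingHom ℚ)

/-- `k` is good for the sequence `P`: `P_{k-1}, P_k, P_{k+1}` are `ℚ`-linearly independent. -/
def Good (P : ℕ → Polynomial ℤ) (k : ℕ) : Prop :=
  LinearIndependent ℚ ![ratPoly (P (k-1)), ratPoly (P k), ratPoly (P (k+1))]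

/-- `τ_k = log H_k / log H_{k-1}`. -/
def tauk (P : ℕ → Polynomial ℤ) (k : ℕ) : ℝ :=
  Real.log (polyHeight (P k)) / Real.log (polyHeight (P (k-1)))

/-- `μ_k = -log |P_{k-1}(ξ)| / log H_k`. -/
def muk (ξ : ℝ) (P : ℕ → Polynomial ℤ) (k : ℕ) : ℝ :=
  - Real.log |Polynomial.aeval ξ (P (k-1))| / Real.log (polyHeight (P k))

/-- `v_k = -log |P_k(ξ)| / log H_k`. -/
def vk (ξ : ℝ) (P : ℕ → Polynomial ℤ) (k : ℕ) : ℝ :=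
  - Real.log |Polynomial.aeval ξ (P k)| / Real.log (polyHeight (P k))

/-- The set of integers `m ≥ k+1` such that `P_{k-1}, …, P_{m-1}` all lie in the
two-dimensional space spanned by `P_{k-1}` and `P_k`; its greatest element is `ℓ(k)`. -/
def ellSet (P : ℕ → Polynomial ℤ) (k : ℕ) : Set ℕ :=
  {m | k + 1 ≤ m ∧ ∀ j, k - 1 ≤ j → j ≤ m - 1 →
    ratPoly (P j) ∈ Submodule.span ℚ {ratPoly (P (k-1)), ratPoly (P k)}}

/-- The set `V_k = {P, T·P, …, T^{n-2}·P}` (as rational polynomials). -/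
def Vset (n : ℕ) (A : Polynomial ℤ) : Set (Polynomial ℚ) :=
  {q | ∃ i ≤ n - 2, q = Polynomial.X ^ i * ratPoly A}

/-- The trajectory `L_P(q) = max(log H(P) - q/(2n-2), log |P(ξ)| + q)`. -/
def LPtraj (n : ℕ) (ξ : ℝ) (Q : Polynomial ℤ) (q : ℝ) : ℝ :=
  max (Real.log (polyHeight Q) - q / (2*(n:ℝ)-2)) (Real.log |Polynomial.aeval ξ Q| + q)

/-- The `j`-th successive minimum function `L_j(q)`: the infimum over sets of `j`
linearly independent integer polynomials of degree at most `2n-2` of the maximum of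
`L_P(q)` over the set. -/
def Lj (n : ℕ) (ξ : ℝ) (j : ℕ) (q : ℝ) : ℝ :=
  sInf {y : ℝ | ∃ S : Finset (Polynomial ℤ), S.card = j ∧
    (∀ Q ∈ S, Q.natDegree ≤ 2*n-2) ∧
    LinearIndependent ℚ (fun Q : {x // x ∈ S} => ratPoly (Q : Polynomial ℤ)) ∧
    y = sSup ((fun Q => LPtraj n ξ Q q) '' (S : Set (Polynomial ℤ)))}

/-! ### Heights -/

lemma natAbs_coeff_le_polyHeight (P : ℤ[X]) (i : ℕ) : (P.coeff i).natAbs ≤ polyHeight P := by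
  by_cases h : i ∈ P.support
  · exact Finset.le_sup (f := fun i => (P.coeff i).natAbs) h
  · simp [notMem_support_iff.1 h]

lemma abs_coeff_le_polyHeight (P : ℤ[X]) (i : ℕ) : |(P.coeff i : ℝ)| ≤ polyHeight P := by
  have h := natAbs_coeff_le_polyHeight P i
  rw [← Int.cast_abs, Int.abs_eq_natAbs]
  exact_mod_cast h

lemma one_le_polyHeight {P : ℤ[X]} (hP : P ≠ 0) : 1 ≤ polyHeight P := by
  refine le_trans ?_ (natAbs_coeff_le_polyHeight P P.natDegree)
  have : P.coeff P.natDegree ≠ 0 := by simpa using hP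
  omega

lemma polyHeight_neg (P : ℤ[X]) : polyHeight (-P) = polyHeight P := by
  simp [polyHeight]

lemma polyHeight_le_C_mul {c : ℤ} (hc : c ≠ 0) (Q : ℤ[X]) :
    polyHeight Q ≤ polyHeight (C c * Q) := by
  refine Finset.sup_le fun i _ => le_trans ?_ (natAbs_coeff_le_polyHeight _ i)
  rw [coeff_C_mul, Int.natAbs_mul]
  exact Nat.le_mul_of_pos_left _ (Int.natAbs_pos.2 hc)

lemma supNorm_map_eq_polyHeight (P : ℤ[X]) :
    (P.map (Int.castRingHom ℂ)).supNorm = polyHeight P := by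
  apply le_antisymm
  · obtain ⟨i, hi⟩ := (P.map (Int.castRingHom ℂ)).exists_eq_supNorm
    rw [hi]
    simpa using abs_coeff_le_polyHeight P i
  · have h : polyHeight P ≤ ⌊(P.map (Int.castRingHom ℂ)).supNorm⌋₊ := by
      refine Finset.sup_le fun i _ => Nat.le_floor ?_
      have := (P.map (Int.castRingHom ℂ)).le_supNorm i
      simpa [Nat.cast_natAbs] using this
    exact (Nat.cast_le.2 h).trans (Nat.floor_le (supNorm_nonneg _))

/-- Heights are multiplicative up to constants depending only on the degree. -/
lemma exists_polyHeight_mul_le (n : ℕ) : ∃ G : ℝ, 1 ≤ G ∧ ∀ A B : ℤ[X], A * B ≠ 0 →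
    (A * B).natDegree ≤ n → (polyHeight A : ℝ) * polyHeight B ≤ G * polyHeight (A * B) := by
  refine ⟨(2 ^ n * 2 ^ n) * √(n + 1), ?_, fun A B h0 hdeg => ?_⟩
  · have h1 : (1 : ℝ) ≤ 2 ^ n := one_le_pow₀ (by norm_num)
    have h2 : (1 : ℝ) ≤ √(n + 1) := Real.one_le_sqrt.2 (by simp)
    nlinarith [mul_le_mul h1 h1 zero_le_one (by positivity)]
  have hA0 : A ≠ 0 := left_ne_zero_of_mul h0
  have hB0 : B ≠ 0 := right_ne_zero_of_mul h0
  have hadd := natDegree_mul hA0 hB0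
  have key : ∀ D : ℤ[X], D.natDegree ≤ n →
      (polyHeight D : ℝ) ≤ 2 ^ n * (D.map (Int.castRingHom ℂ)).mahlerMeasure := by
    intro D hD
    rw [← supNorm_map_eq_polyHeight]
    refine (supNorm_le_choose_natDegree_div_two_mul_mahlerMeasure _).trans ?_
    gcongr
    · exact mahlerMeasure_nonneg _
    · have h1 := Nat.choose_le_two_pow (D.map (Int.castRingHom ℂ)).natDegree
        ((D.map (Int.castRingHom ℂ)).natDegree / 2)
      have h2 : 2 ^ (D.map (Int.castRingHom ℂ)).natDegree ≤ 2 ^ n :=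
        Nat.pow_le_pow_right (by norm_num) (natDegree_map_le.trans hD)
      exact_mod_cast h1.trans h2
  have hA := key A (by omega)
  have hB := key B (by omega)
  have hAB := mahlerMeasure_le_sqrt_natDegree_add_one_mul_supNorm
    ((A * B).map (Int.castRingHom ℂ))
  rw [supNorm_map_eq_polyHeight, Polynomial.map_mul, mahlerMeasure_mul, ← Polynomial.map_mul] at hAB
  have hs : √(((A * B).map (Int.castRingHom ℂ)).natDegree + 1 : ℝ) ≤ √(n + 1) := by
    gcongr
    exact natDegree_map_le.trans hdeg
  calc (polyHeight A : ℝ) * polyHeight B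
      ≤ (2 ^ n * (A.map (Int.castRingHom ℂ)).mahlerMeasure) *
        (2 ^ n * (B.map (Int.castRingHom ℂ)).mahlerMeasure) := by
        gcongr
        exact mul_nonneg (by positivity) (mahlerMeasure_nonneg _)
    _ = (2 ^ n * 2 ^ n) * ((A.map (Int.castRingHom ℂ)).mahlerMeasure *
        (B.map (Int.castRingHom ℂ)).mahlerMeasure) := by ring
    _ ≤ (2 ^ n * 2 ^ n) * (√(n + 1) * polyHeight (A * B)) := by
        refine mul_le_mul_of_nonneg_left (hAB.trans ?_) (by positivity)
        gcongr
    _ = _ := by ring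

lemma finite_polyHeight_le (n N : ℕ) :
    {Q : ℤ[X] | Q.natDegree ≤ n ∧ polyHeight Q ≤ N}.Finite := by
  have hfin : (Set.univ.pi fun _ : Fin (n + 1) => Set.Icc (-(N : ℤ)) N).Finite :=
    Set.Finite.pi fun _ => Set.finite_Icc _ _
  refine Set.Finite.of_finite_image (f := fun Q : ℤ[X] => fun i : Fin (n + 1) => Q.coeff i)
    (hfin.subset ?_) ?_
  · rintro _ ⟨Q, hQ, rfl⟩ i -
    have := natAbs_coeff_le_polyHeight Q i
    have := hQ.2
    simp only [Set.mem_Icc]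
    omega
  · intro Q hQ R hR h
    ext i
    rcases Nat.lt_or_ge i (n + 1) with hi | hi
    · exact congrFun h ⟨i, hi⟩
    · rw [coeff_eq_zero_of_natDegree_lt (lt_of_le_of_lt hQ.1 hi),
        coeff_eq_zero_of_natDegree_lt (lt_of_le_of_lt hR.1 hi)]

/-! ### Determinant estimate -/

lemma one_le_factorial_mul_of_linearIndependent {ι : Type*} [Fintype ι] (ξ : ℝ) (Q : ι → ℤ[X])
    (hdeg : ∀ i, (Q i).natDegree < Fintype.card ι)
    (hli : LinearIndependent ℚ fun i => ratPoly (Q i)) (h : ι → ℝ) (ε : ℝ)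
    (hh : ∀ i, (polyHeight (Q i) : ℝ) ≤ h i) (hε : ∀ i, |aeval ξ (Q i)| ≤ ε * h i)
    [Nonempty ι] :
    1 ≤ ((Fintype.card ι).factorial : ℝ) * (ε * ∏ i, h i) := by
  classical
  obtain ⟨m, hm⟩ : ∃ m, Fintype.card ι = m + 1 :=
    ⟨_, (Nat.succ_pred_eq_of_pos Fintype.card_pos).symm⟩
  let e : ι ≃ Fin (m + 1) := Fintype.equivFinOfCardEq hm
  let M : Matrix (Fin (m + 1)) (Fin (m + 1)) ℤ :=
    Matrix.of fun j i => (Q (e.symm i)).coeff j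
  have hdeg' : ∀ i, (Q i).natDegree < m + 1 := fun i => hm ▸ hdeg i
  have hdet : M.det ≠ 0 := by
    intro h0
    have h1 : (M.map (Int.castRingHom ℚ)).det = 0 := by
      rw [← RingHom.mapMatrix_apply, ← RingHom.map_det, h0, map_zero]
    obtain ⟨v, hv0, hv⟩ := Matrix.exists_mulVec_eq_zero_iff.2 h1
    apply hv0
    have h2 : ∑ i, v (e i) • ratPoly (Q i) = 0 := by
      ext j
      rw [finsetSum_coeff, coeff_zero]
      rcases Nat.lt_or_ge j (m + 1) with hj | hj
      · have := congrFun hv ⟨j, hj⟩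
        rw [Matrix.mulVec, dotProduct] at this
        rw [← Equiv.sum_comp e] at this
        simpa [M, ratPoly, mul_comm] using this
      · refine Finset.sum_eq_zero fun i _ => ?_
        simp [ratPoly, coeff_eq_zero_of_natDegree_lt (lt_of_lt_of_le (hdeg' i) hj)]
    have h3 := Fintype.linearIndependent_iff.1 hli (fun i => v (e i)) h2
    funext i
    simpa using h3 (e.symm i)
  have h1 : (1 : ℝ) ≤ |(M.det : ℝ)| := by
    rw [← Int.cast_abs]
    exact_mod_cast Int.one_le_abs hdet
  let A : Matrix (Fin (m + 1)) (Fin (m + 1)) ℝ := M.map (Int.castRingHom ℝ)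
  have hA : A.det = (M.det : ℝ) := by
    simp only [A]
    rw [← RingHom.mapMatrix_apply, ← RingHom.map_det]
    rfl
  let B := A.updateRow 0 fun i => aeval ξ (Q (e.symm i))
  have hB : B.det = A.det := by
    have h2 : (fun i => aeval ξ (Q (e.symm i))) = 
        ∑ j : Fin (m + 1), ξ ^ (j : ℕ) • A j := by
      funext i
      rw [aeval_eq_sum_range' (hdeg' _), Finset.sum_range]
      simp [A, M, mul_comm]
    have h3 := Matrix.det_updateRow_sum A 0 fun j => ξ ^ (j : ℕ)
    simp only [B, h2]
    simpa using h3
  have hh0 : ∀ i, 0 ≤ h i := fun i => (Nat.cast_nonneg _).trans (hh i)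
  have hε0 : ∀ i, 0 ≤ ε * h i := fun i => (abs_nonneg _).trans (hε i)
  have hbound : ∀ σ : Equiv.Perm (Fin (m + 1)), |∏ i, B (σ i) i| ≤ ε * ∏ i, h i := by
    intro σ
    rw [Finset.abs_prod, ← Equiv.prod_comp e.symm h,
      ← Finset.mul_prod_erase Finset.univ _ (Finset.mem_univ (σ.symm 0)),
      ← Finset.mul_prod_erase Finset.univ _ (Finset.mem_univ (σ.symm 0)), ← mul_assoc]
    refine mul_le_mul ?_ ?_ (Finset.prod_nonneg fun _ _ => abs_nonneg _) (hε0 _)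
    · simpa [B] using hε (e.symm (σ.symm 0))
    · refine Finset.prod_le_prod (fun _ _ => abs_nonneg _) fun i hi => ?_
      have : σ i ≠ 0 := fun h => (Finset.mem_erase.1 hi).1 (by rw [← h]; simp)
      simp only [B, Matrix.updateRow_ne this]
      exact (abs_coeff_le_polyHeight _ _).trans (hh _)
  calc (1 : ℝ) ≤ |B.det| := by rw [hB, hA]; exact h1
    _ ≤ ∑ σ : Equiv.Perm (Fin (m + 1)), ε * ∏ i, h i := by
        rw [Matrix.det_apply]
        refine (Finset.abs_sum_le_sum_abs _ _).trans (Finset.sum_le_sum fun σ _ => ?_)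
        rcases Int.units_eq_one_or (Equiv.Perm.sign σ) with hs | hs <;>
          simpa [hs] using hbound σ
    _ = _ := by simp [hm, Fintype.card_perm]

/-! ### Linear independence of shifted polynomials -/

lemma eq_and_eq_of_mul_add_mul_eq {p q A B A' B' : ℚ[X]} (hq : Irreducible q) (hpq : ¬ q ∣ p)
    (hA : A.degree < q.degree) (hA' : A'.degree < q.degree)
    (h : A * p + B * q = A' * p + B' * q) : A = A' ∧ B = B' := by
  have h1 : (A - A') * p = q * (B' - B) := by linear_combination h
  have h2 : q ∣ A - A' := (hq.prime.dvd_or_dvd ⟨_, h1⟩).resolve_right hpq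
  have h3 : A - A' = 0 := eq_zero_of_dvd_of_degree_lt h2
    ((degree_sub_le _ _).trans_lt (max_lt hA hA'))
  rw [h3, zero_mul, zero_eq_mul, or_iff_right hq.ne_zero] at h1
  exact ⟨sub_eq_zero.1 h3, (sub_eq_zero.1 h1).symm⟩

/-- The polynomials `p, Xp, …, X^{a-1}p, q, Xq, …, X^{b-1}q`. -/
def shifts (a b : ℕ) (p q : ℚ[X]) : Fin a ⊕ Fin b → ℚ[X] :=
  Sum.elim (fun i => X ^ (i : ℕ) * p) fun j => X ^ (j : ℕ) * q

lemma sum_smul_shifts (a b : ℕ) (p q : ℚ[X]) (c : Fin a ⊕ Fin b → ℚ) :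
    ∑ i, c i • shifts a b p q i =
      (∑ i : Fin a, C (c (.inl i)) * X ^ (i : ℕ)) * p +
        (∑ j : Fin b, C (c (.inr j)) * X ^ (j : ℕ)) * q := by
  simp [shifts, Finset.sum_mul, smul_eq_C_mul, mul_assoc]

lemma coeff_sum_fin_C_mul_X_pow {a : ℕ} (c : Fin a → ℚ) (i : Fin a) :
    (∑ j : Fin a, C (c j) * X ^ (j : ℕ)).coeff i = c i := by
  simp [finsetSum_coeff, coeff_X_pow, Fin.val_inj]

lemma linearIndependent_shifts {p q : ℚ[X]} (hq : Irreducible q) (hpq : ¬ q ∣ p) {a b : ℕ}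
    (ha : a ≤ q.natDegree) : LinearIndependent ℚ (shifts a b p q) := by
  refine Fintype.linearIndependent_iff.2 fun c hc => ?_
  rw [sum_smul_shifts] at hc
  have hdeg : (∑ i : Fin a, C (c (.inl i)) * X ^ (i : ℕ)).degree < q.degree := by
    refine (degree_sum_fin_lt _).trans_le ?_
    rw [degree_eq_natDegree hq.ne_zero]
    exact_mod_cast ha
  obtain ⟨h1, h2⟩ := eq_and_eq_of_mul_add_mul_eq (A' := 0) (B' := 0) hq hpq hdeg
    (by rw [degree_zero]; exact bot_lt_iff_ne_bot.2 (degree_ne_bot.2 hq.ne_zero)) (by simpa using hc)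
  rintro (i | j)
  · simpa only [coeff_sum_fin_C_mul_X_pow (fun i => c (.inl i)), coeff_zero] using
      congrArg (coeff · (i : ℕ)) h1
  · simpa only [coeff_sum_fin_C_mul_X_pow (fun j => c (.inr j)), coeff_zero] using
      congrArg (coeff · (j : ℕ)) h2

lemma exists_of_mem_span_shifts {a b : ℕ} {p q r : ℚ[X]}
    (hr : r ∈ Submodule.span ℚ (Set.range (shifts a b p q))) :
    ∃ A B : ℚ[X], A.degree < a ∧ B.degree < b ∧ r = A * p + B * q := by
  obtain ⟨c, rfl⟩ := (Submodule.mem_span_range_iff_exists_fun ℚ).1 hr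
  exact ⟨_, _, degree_sum_fin_lt _, degree_sum_fin_lt _, sum_smul_shifts a b p q c⟩

/-- If `p, q, r` are linearly independent and `q` is irreducible of degree `m + 2` not dividing
`p`, then some shift of `r` is not in the span of the shifts of `p` and `q`. -/
lemma exists_shift_notMem_span {p q r : ℚ[X]} (hq : Irreducible q) (hpq : ¬ q ∣ p) {m : ℕ}
    (hm : q.natDegree = m + 2) (hli : LinearIndependent ℚ ![p, q, r]) :
    ∃ i ≤ m, X ^ i * r ∉ Submodule.span ℚ (Set.range (shifts (m + 1) (m + 1) p q)) := by
  by_contra! hcon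
  have hrep := fun i hi => exists_of_mem_span_shifts (hcon i hi)
  have hqd : q.degree = ((m + 2 : ℕ) : WithBot ℕ) := by rw [degree_eq_natDegree hq.ne_zero, hm]
  obtain ⟨A, B, hA, hB, hr⟩ := hrep 0 (Nat.zero_le m)
  rw [pow_zero, one_mul] at hr
  have hind : ∀ i ≤ m, (X ^ i * A).degree < ((m + 1 : ℕ) : WithBot ℕ) ∧
      (X ^ i * B).degree < ((m + 1 : ℕ) : WithBot ℕ) := by
    intro i
    induction i with
    | zero => intro _; simpa using ⟨hA, hB⟩
    | succ i ih =>
      intro hi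
      obtain ⟨A', B', hA', hB', hr'⟩ := hrep (i + 1) hi
      have hlt : (X ^ (i + 1) * A).degree < q.degree := by
        by_cases hA0 : A = 0
        · rw [hA0, mul_zero, degree_zero, hqd]
          exact WithBot.bot_lt_coe _
        have := (ih (by omega)).1
        rw [degree_mul, degree_X_pow, degree_eq_natDegree hA0] at this ⊢
        rw [hqd]
        norm_cast at this ⊢
        omega
      have hlt' : A'.degree < q.degree := hA'.trans (by rw [hqd]; norm_cast; omega)
      obtain ⟨h1, h2⟩ := eq_and_eq_of_mul_add_mul_eq (A := X ^ (i + 1) * A) (B := X ^ (i + 1) * B)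
        (A' := A') (B' := B') hq hpq hlt hlt' (by rw [← hr', hr]; ring)
      rw [h1, h2]
      exact ⟨hA', hB'⟩
  have hconst : ∀ D : ℚ[X], (X ^ m * D).degree < ((m + 1 : ℕ) : WithBot ℕ) → D = C (D.coeff 0) := by
    intro D hD
    refine eq_C_of_degree_le_zero ?_
    by_cases hD0 : D = 0
    · simp [hD0]
    rw [degree_mul, degree_X_pow, degree_eq_natDegree hD0] at hD
    rw [degree_eq_natDegree hD0]
    norm_cast at hD ⊢
    omega
  have h0 := Fintype.linearIndependent_iff.1 hli ![A.coeff 0, B.coeff 0, -1] (by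
    rw [Fin.sum_univ_three]
    simp only [Matrix.cons_val, smul_eq_C_mul]
    rw [← hconst A (hind m le_rfl).1, ← hconst B (hind m le_rfl).2, hr]
    simp) 2
  simp at h0

/-! ### Consequences for values of integer polynomials -/

lemma polyHeight_X_pow_mul_le (i : ℕ) (P : ℤ[X]) : polyHeight (X ^ i * P) ≤ polyHeight P := by
  refine Finset.sup_le fun j _ => ?_
  rw [coeff_X_pow_mul']
  split_ifs
  · exact natAbs_coeff_le_polyHeight _ _
  · simp

lemma abs_aeval_X_pow_mul_le (ξ : ℝ) {i N : ℕ} (hi : i ≤ N) (P : ℤ[X]) :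
    |aeval ξ (X ^ i * P)| ≤ max 1 |ξ| ^ N * |aeval ξ P| := by
  rw [map_mul, map_pow, aeval_X, abs_mul, abs_pow]
  gcongr
  calc |ξ| ^ i ≤ max 1 |ξ| ^ i := by gcongr; exact le_max_right _ _
    _ ≤ max 1 |ξ| ^ N := pow_le_pow_right₀ (le_max_left _ _) hi

lemma ratPoly_X_pow_mul (i : ℕ) (P : ℤ[X]) : ratPoly (X ^ i * P) = X ^ i * ratPoly P := by
  simp [ratPoly]

lemma natDegree_ratPoly (P : ℤ[X]) : (ratPoly P).natDegree = P.natDegree :=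
  natDegree_map_eq_of_injective (RingHom.injective_int _) P

lemma ratPoly_ne_zero {P : ℤ[X]} (hP : P ≠ 0) : ratPoly P ≠ 0 :=
  (Polynomial.map_ne_zero_iff (RingHom.injective_int _)).2 hP

/-- The integer polynomials whose images are the `shifts`. -/
def intShifts (a b : ℕ) (P Q : ℤ[X]) : Fin a ⊕ Fin b → ℤ[X] :=
  Sum.elim (fun i => X ^ (i : ℕ) * P) fun j => X ^ (j : ℕ) * Q

lemma ratPoly_intShifts (a b : ℕ) (P Q : ℤ[X]) (i : Fin a ⊕ Fin b) :
    ratPoly (intShifts a b P Q i) = shifts a b (ratPoly P) (ratPoly Q) i := by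
  rcases i with i | i <;> simp [intShifts, shifts, ratPoly_X_pow_mul]

/-- Resultant estimate. -/
lemma one_le_mul_of_irreducible_of_not_dvd (ξ : ℝ) {P Q : ℤ[X]} {n m : ℕ}
    (hQ : Irreducible (ratPoly Q)) (hPQ : ¬ ratPoly Q ∣ ratPoly P) (hP : P.natDegree ≤ n)
    (hm : Q.natDegree = m) {N : ℕ} (hnm : n + m ≤ N) {ε : ℝ}
    (hεP : |aeval ξ P| ≤ ε * polyHeight P) (hεQ : |aeval ξ Q| ≤ ε * polyHeight Q) :
    1 ≤ (N.factorial : ℝ) * max 1 |ξ| ^ N * (ε * (polyHeight P ^ m * polyHeight Q ^ n)) := by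
  have hm0 : 0 < m := by
    rw [← hm, ← natDegree_ratPoly]
    exact hQ.natDegree_pos
  have : Nonempty (Fin m ⊕ Fin n) := ⟨.inl ⟨0, hm0⟩⟩
  have h := one_le_factorial_mul_of_linearIndependent ξ (intShifts m n P Q)
    (by
      rintro (i | i)
      · refine (natDegree_mul_le).trans_lt ?_
        rw [natDegree_X_pow]
        have := i.2
        simp
        omega
      · refine (natDegree_mul_le).trans_lt ?_
        rw [natDegree_X_pow]
        have := i.2
        simp
        omega)
    (by
      simp only [ratPoly_intShifts]
      exact linearIndependent_shifts hQ hPQ (by rw [natDegree_ratPoly, hm]))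
    (Sum.elim (fun _ => (polyHeight P : ℝ)) fun _ => (polyHeight Q : ℝ)) (max 1 |ξ| ^ N * ε)
    (by
      rintro (i | i) <;> simpa [intShifts] using polyHeight_X_pow_mul_le _ _)
    (by
      rintro (i | i)
      · refine (abs_aeval_X_pow_mul_le ξ (N := N) (by omega) P).trans ?_
        rw [mul_assoc]
        exact mul_le_mul_of_nonneg_left hεP (by positivity)
      · refine (abs_aeval_X_pow_mul_le ξ (N := N) (by omega) Q).trans ?_
        rw [mul_assoc]
        exact mul_le_mul_of_nonneg_left hεQ (by positivity))
  simp only [Fintype.card_sum, Fintype.card_fin, Fintype.prod_sum_type, Sum.elim_inl,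
    Sum.elim_inr, Finset.prod_const, Finset.card_univ] at h
  have hpos : 0 ≤ max 1 |ξ| ^ N * ε * ((polyHeight P : ℝ) ^ m * (polyHeight Q : ℝ) ^ n) := by
    by_contra! hneg
    have := mul_nonpos_of_nonneg_of_nonpos (Nat.cast_nonneg (α := ℝ) (m + n).factorial) hneg.le
    linarith
  have hfac : ((m + n).factorial : ℝ) ≤ N.factorial := by
    exact_mod_cast Nat.factorial_le (by omega)
  calc (1 : ℝ) ≤ _ := h
    _ ≤ N.factorial * (max 1 |ξ| ^ N * ε * ((polyHeight P : ℝ) ^ m * (polyHeight Q : ℝ) ^ n)) :=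
        mul_le_mul_of_nonneg_right hfac hpos
    _ = _ := by ring

/-- Determinant estimate for the shifts of three linearly independent polynomials. -/
lemma one_le_mul_of_linearIndependent_three (ξ : ℝ) {P Q R : ℤ[X]} {m : ℕ}
    (hQ : Irreducible (ratPoly Q)) (hPQ : ¬ ratPoly Q ∣ ratPoly P) (hP : P.natDegree ≤ m + 2)
    (hQm : Q.natDegree = m + 2) (hR : R.natDegree ≤ m + 2)
    (hli : LinearIndependent ℚ ![ratPoly P, ratPoly Q, ratPoly R]) {ε : ℝ}
    (hεP : |aeval ξ P| ≤ ε * polyHeight P) (hεQ : |aeval ξ Q| ≤ ε * polyHeight Q)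
    (hεR : |aeval ξ R| ≤ ε * polyHeight R) :
    1 ≤ ((2 * m + 3).factorial : ℝ) * max 1 |ξ| ^ m *
      (ε * (polyHeight P ^ (m + 1) * polyHeight Q ^ (m + 1) * polyHeight R)) := by
  obtain ⟨i₀, hi₀, hmem⟩ := exists_shift_notMem_span hQ hPQ (by rw [natDegree_ratPoly, hQm]) hli
  let F : Option (Fin (m + 1) ⊕ Fin (m + 1)) → ℤ[X] := fun o =>
    o.elim (X ^ i₀ * R) (intShifts (m + 1) (m + 1) P Q)
  have hdegle : ∀ (i : ℕ) (D : ℤ[X]), i ≤ m → D.natDegree ≤ m + 2 →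
      (X ^ i * D).natDegree < 2 * m + 3 := by
    intro i D hi hD
    refine (natDegree_mul_le).trans_lt ?_
    rw [natDegree_X_pow]
    omega
  have hval : ∀ (i : ℕ) (D : ℤ[X]), i ≤ m → |aeval ξ D| ≤ ε * polyHeight D →
      |aeval ξ (X ^ i * D)| ≤ max 1 |ξ| ^ m * ε * polyHeight D := by
    intro i D hi hD
    refine (abs_aeval_X_pow_mul_le ξ hi D).trans ?_
    rw [mul_assoc]
    exact mul_le_mul_of_nonneg_left hD (by positivity)
  have hcard : Fintype.card (Option (Fin (m + 1) ⊕ Fin (m + 1))) = 2 * m + 3 := by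
    simp
    ring
  have h := one_le_factorial_mul_of_linearIndependent ξ F
    (by
      rw [hcard]
      rintro (_ | i | i)
      · exact hdegle _ _ hi₀ hR
      · exact hdegle _ _ (by omega) hP
      · exact hdegle _ _ (by omega) hQm.le)
    (by
      rw [linearIndependent_option]
      have hF : (fun o => ratPoly (F o)) ∘ (fun i => some i : Fin (m + 1) ⊕ Fin (m + 1) → _) =
          shifts (m + 1) (m + 1) (ratPoly P) (ratPoly Q) :=
        funext fun i => ratPoly_intShifts _ _ _ _ i
      refine ⟨?_, ?_⟩
      · erw [hF]
        exact linearIndependent_shifts hQ hPQ (by rw [natDegree_ratPoly, hQm]; omega)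
      · erw [hF]
        simpa [F, ratPoly_X_pow_mul] using hmem)
    (fun o => o.elim (polyHeight R : ℝ)
      (Sum.elim (fun _ => (polyHeight P : ℝ)) fun _ => (polyHeight Q : ℝ))) (max 1 |ξ| ^ m * ε)
    (by
      rintro (_ | i | i) <;> simpa [F, intShifts] using polyHeight_X_pow_mul_le _ _)
    (by
      rintro (_ | i | i)
      · exact hval _ _ hi₀ hεR
      · exact hval _ _ (by omega) hεP
      · exact hval _ _ (by omega) hεQ)
  rw [hcard] at h
  simp only [Fintype.prod_option, Fintype.prod_sum_type, Sum.elim_inl, Option.elim_none,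
    Option.elim_some, Sum.elim_inr, Finset.prod_const, Finset.card_univ, Fintype.card_fin] at h
  refine h.trans (le_of_eq ?_)
  ring

/-! ### Irreducibility of best approximations -/

lemma exists_mul_or_exists_C_mul_irreducible {R : ℤ[X]} (hR : 0 < R.natDegree) :
    (∃ A B : ℤ[X], R = A * B ∧ A.natDegree < R.natDegree ∧ B.natDegree < R.natDegree) ∨
      ∃ (c : ℤ) (Q : ℤ[X]), c ≠ 0 ∧ Irreducible Q ∧ R = C c * Q := by
  have hR0 : R ≠ 0 := by rintro rfl; simp at hR
  have hc : R.content ≠ 0 := content_eq_zero_iff.not.2 hR0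
  by_cases hirr : Irreducible R.primPart
  · exact Or.inr ⟨_, _, hc, hirr, R.eq_C_content_mul_primPart⟩
  left
  have hnu : ¬ IsUnit R.primPart := by
    intro hu
    have := natDegree_eq_zero_of_isUnit hu
    rw [natDegree_primPart] at this
    omega
  simp only [irreducible_iff, hnu, not_false_iff, true_and, not_forall, not_or] at hirr
  obtain ⟨a, b, hab, ha, hb⟩ := hirr
  have key : ∀ d : ℤ[X], d ∣ R.primPart → ¬ IsUnit d → 0 < d.natDegree := by
    intro d hd hdu
    by_contra! h0
    obtain ⟨r, rfl⟩ := natDegree_eq_zero.1 (Nat.le_zero.1 h0)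
    exact hdu (isUnit_C.2 (R.isPrimitive_primPart r hd))
  have ha' := key a ⟨b, hab⟩ ha
  have hb' := key b ⟨a, by rw [hab, mul_comm]⟩ hb
  have hsum : a.natDegree + b.natDegree = R.natDegree := by
    rw [← R.natDegree_primPart, hab, natDegree_mul]
    · rintro rfl; simp at ha'
    · rintro rfl; simp at hb'
  refine ⟨C R.content * a, b, ?_, ?_, by omega⟩
  · rw [mul_assoc, ← hab]
    exact R.eq_C_content_mul_primPart
  · rw [natDegree_C_mul hc]
    omega

lemma aeval_ne_zero_of_transcendental {ξ : ℝ} (hξ : Transcendental ℚ ξ) {Q : ℤ[X]} (hQ : Q ≠ 0) :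
    aeval ξ Q ≠ 0 := by
  intro h
  refine hξ ⟨ratPoly Q, ratPoly_ne_zero hQ, ?_⟩
  rw [ratPoly, ← h]
  exact aeval_map_algebraMap ℚ ξ Q

lemma div_le_abs_aeval_mul {ξ G c : ℝ} {E : ℕ} {A B : ℤ[X]} (hG : 0 < G) (hc : 0 ≤ c)
    (hAB : (polyHeight A : ℝ) * polyHeight B ≤ G * polyHeight (A * B))
    (hA : c ≤ |aeval ξ A| * polyHeight A ^ E) (hB : c ≤ |aeval ξ B| * polyHeight B ^ E) :
    c * c / G ^ E ≤ |aeval ξ (A * B)| * polyHeight (A * B) ^ E := by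
  rw [div_le_iff₀ (by positivity), map_mul, abs_mul]
  calc c * c ≤ (|aeval ξ A| * polyHeight A ^ E) * (|aeval ξ B| * polyHeight B ^ E) := by gcongr
    _ = |aeval ξ A| * |aeval ξ B| * (polyHeight A * polyHeight B) ^ E := by ring
    _ ≤ |aeval ξ A| * |aeval ξ B| * (G * polyHeight (A * B)) ^ E := by gcongr
    _ = _ := by ring

namespace IsBestApproxSeq

variable {n : ℕ} {ξ : ℝ} {P : ℕ → ℤ[X]}

lemma height_strictMono (hP : IsBestApproxSeq n ξ P) :
    StrictMono fun k => polyHeight (P (k + 1)) :=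
  strictMono_nat_of_lt_succ fun k => hP.height_lt (k + 1) (by omega)

lemma le_height (hP : IsBestApproxSeq n ξ P) (k : ℕ) : k ≤ polyHeight (P (k + 1)) :=
  hP.height_strictMono.le_apply

lemma height_le_of_le (hP : IsBestApproxSeq n ξ P) {j k : ℕ} (hj : 1 ≤ j) (hjk : j ≤ k) :
    polyHeight (P j) ≤ polyHeight (P k) := by
  obtain ⟨j, rfl⟩ := Nat.exists_eq_add_of_le' hj
  obtain ⟨k, rfl⟩ := Nat.exists_eq_add_of_le' (hj.trans hjk)
  exact hP.height_strictMono.monotone (by omega)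

lemma abs_aeval_le_of_le (hP : IsBestApproxSeq n ξ P) {j k : ℕ} (hj : 1 ≤ j) (hjk : j ≤ k) :
    |aeval ξ (P k)| ≤ |aeval ξ (P j)| :=
  hP.isMin k (hj.trans hjk) (P j) (hP.ne_zero j hj) (hP.deg_le j hj) (hP.height_le_of_le hj hjk)

lemma abs_aeval_le_of_height_lt (hP : IsBestApproxSeq n ξ P) {k : ℕ} {Q : ℤ[X]}
    (hQ0 : Q ≠ 0) (hQ : Q.natDegree ≤ n) (hlt : polyHeight Q < polyHeight (P (k + 1))) :
    |aeval ξ (P k)| ≤ |aeval ξ Q| := by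
  have hfin : {R : ℤ[X] | R ≠ 0 ∧ R.natDegree ≤ n ∧ polyHeight R ≤ polyHeight Q}.Finite :=
    (finite_polyHeight_le n (polyHeight Q)).subset fun R hR => hR.2
  obtain ⟨R, ⟨hR0, hRn, hRQ⟩, hmin⟩ :=
    Set.exists_min_image _ (fun R => |aeval ξ R|) hfin ⟨Q, hQ0, hQ, le_rfl⟩
  obtain ⟨j, hj, hRj⟩ := hP.complete R hR0 hRn fun S hS0 hSn hSR =>
    hmin S ⟨hS0, hSn, hSR.trans hRQ⟩
  have hRj' : polyHeight R = polyHeight (P j) ∧ |aeval ξ R| = |aeval ξ (P j)| := by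
    rcases hRj with rfl | rfl <;> simp [polyHeight_neg]
  have hjk : j ≤ k := by
    by_contra! hkj
    have := hP.height_le_of_le (by omega : 1 ≤ k + 1) hkj
    omega
  calc |aeval ξ (P k)| ≤ |aeval ξ (P j)| := hP.abs_aeval_le_of_le hj hjk
    _ = |aeval ξ R| := hRj'.2.symm
    _ ≤ |aeval ξ Q| := hmin Q ⟨hQ0, hQ, le_rfl⟩

/-- Irreducible polynomials of degree less than `n` are not too small at `ξ` when the uniform
exponent exceeds `2n - 2`. -/
lemma exists_lower_bound_irreducible (hP : IsBestApproxSeq n ξ P) (hξ : Transcendental ℚ ξ)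
    (hsmall : ∀ M : ℝ, ∀ᶠ k in atTop,
      M * (|aeval ξ (P k)| * polyHeight (P (k + 1)) ^ (2 * n - 2)) < 1) :
    ∃ c > 0, ∀ Q : ℤ[X], Irreducible Q → 0 < Q.natDegree → Q.natDegree < n →
      c ≤ |aeval ξ Q| * polyHeight Q ^ (2 * n - 2) := by
  obtain ⟨G, hG1, hG⟩ := exists_polyHeight_mul_le n
  set K₀ : ℝ := ((2 * n).factorial : ℝ) * max 1 |ξ| ^ (2 * n) with hK₀
  have hK₀pos : 0 < K₀ := by positivity
  obtain ⟨K, hK⟩ := eventually_atTop.1 ((hsmall (K₀ * G ^ n)).and (eventually_ge_atTop 1))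
  have hK1 : 1 ≤ K := (hK K le_rfl).2
  obtain ⟨L, hL⟩ := exists_nat_ge (G * polyHeight (P K))
  have hPL : 0 < |aeval ξ (P (L + 1))| :=
    abs_pos.2 (aeval_ne_zero_of_transcendental hξ (hP.ne_zero _ (by omega)))
  refine ⟨min |aeval ξ (P (L + 1))| (1 / K₀), lt_min hPL (by positivity), ?_⟩
  intro Q hQ hm0 hmn
  set m := Q.natDegree with hm
  have hQ0 : Q ≠ 0 := hQ.ne_zero
  have hh1 : (1 : ℝ) ≤ polyHeight Q := by exact_mod_cast one_le_polyHeight hQ0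
  rcases le_or_gt (polyHeight Q : ℝ) (G * polyHeight (P K)) with hcase | hcase
  · refine (min_le_left _ _).trans ?_
    have hle : polyHeight Q ≤ polyHeight (P (L + 1)) :=
      (Nat.cast_le.1 (hcase.trans hL) : polyHeight Q ≤ L).trans (hP.le_height L)
    have := hP.isMin (L + 1) (by omega) Q hQ0 hmn.le hle
    exact this.trans (le_mul_of_one_le_right (abs_nonneg _) (one_le_pow₀ hh1))
  obtain ⟨k, hkK, hk1, hk2⟩ : ∃ k ≥ K, G * polyHeight (P k) < polyHeight Q ∧
      polyHeight Q ≤ G * polyHeight (P (k + 1)) := by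
    by_contra! hcon
    have hall : ∀ k ≥ K, G * polyHeight (P k) < polyHeight Q := by
      intro k hk
      induction k, hk using Nat.le_induction with
      | base => exact hcase
      | succ k hk ih => exact hcon k hk ih
    have h1 := hall (polyHeight Q + K + 1) (by omega)
    have h2 : ((polyHeight Q + K : ℕ) : ℝ) ≤ polyHeight (P (polyHeight Q + K + 1)) := by
      exact_mod_cast hP.le_height _
    push_cast at h2
    have h3 : (0 : ℝ) ≤ K := Nat.cast_nonneg _
    nlinarith
  obtain ⟨hsm, hk⟩ := hK k hkK
  have hPk0 := hP.ne_zero k hk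
  have hHk1 : (1 : ℝ) ≤ polyHeight (P k) := by exact_mod_cast one_le_polyHeight hPk0
  have hHkk : (polyHeight (P k) : ℝ) ≤ polyHeight (P (k + 1)) := by
    exact_mod_cast (hP.height_lt k hk).le
  have hprim : Q.IsPrimitive := hQ.isPrimitive hm0.ne'
  have hirr : Irreducible (ratPoly Q) :=
    (IsPrimitive.Int.irreducible_iff_irreducible_map_cast hprim).1 hQ
  have hndvd : ¬ ratPoly Q ∣ ratPoly (P k) := by
    intro hdvd
    obtain ⟨S, hS⟩ := (IsPrimitive.Int.dvd_iff_map_cast_dvd_map_cast Q (P k) hprim).2 hdvd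
    have hQS := hG Q S (hS ▸ hPk0) (hS ▸ hP.deg_le k hk)
    rw [← hS] at hQS
    have hS0 : S ≠ 0 := by rintro rfl; exact hPk0 (by simpa using hS)
    have hS1 : (1 : ℝ) ≤ polyHeight S := by exact_mod_cast one_le_polyHeight hS0
    nlinarith
  have hres : ∀ ε : ℝ, |aeval ξ (P k)| ≤ ε * polyHeight (P k) → |aeval ξ Q| ≤ ε * polyHeight Q →
      1 ≤ K₀ * (ε * (polyHeight (P k) ^ m * polyHeight Q ^ n)) := fun ε =>
    one_le_mul_of_irreducible_of_not_dvd ξ hirr hndvd (hP.deg_le k hk) hm.symm (by omega)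
  obtain ⟨m', hm'⟩ : ∃ m', m = m' + 1 := ⟨m - 1, by omega⟩
  obtain ⟨n', hn'⟩ : ∃ n', n = n' + 1 := ⟨n - 1, by omega⟩
  refine (min_le_right _ _).trans ?_
  rw [div_le_iff₀ hK₀pos]
  rcases le_total (|aeval ξ Q| / polyHeight Q) (|aeval ξ (P k)| / polyHeight (P k)) with hc | hc
  · exfalso
    have h1 := hres (|aeval ξ (P k)| / polyHeight (P k)) (by rw [div_mul_cancel₀ _ (by positivity)])
      ((div_le_iff₀ (by positivity)).1 hc)
    have h2 : K₀ * (|aeval ξ (P k)| / polyHeight (P k) *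
        (polyHeight (P k) ^ m * polyHeight Q ^ n)) =
        K₀ * (|aeval ξ (P k)| * (polyHeight (P k) ^ m' * polyHeight Q ^ n)) := by
      rw [hm', pow_succ']
      field_simp
    have h3 : (polyHeight (P k) : ℝ) ^ m' * polyHeight Q ^ n ≤
        G ^ n * polyHeight (P (k + 1)) ^ (2 * n - 2) := by
      calc (polyHeight (P k) : ℝ) ^ m' * polyHeight Q ^ n
          ≤ polyHeight (P (k + 1)) ^ m' * (G * polyHeight (P (k + 1))) ^ n := by gcongr
        _ = G ^ n * polyHeight (P (k + 1)) ^ (m' + n) := by ring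
        _ ≤ _ := by
          refine mul_le_mul_of_nonneg_left ?_ (by positivity)
          exact pow_le_pow_right₀ (hHk1.trans hHkk) (by omega)
    have h4 : K₀ * (|aeval ξ (P k)| * (polyHeight (P k) ^ m' * polyHeight Q ^ n)) ≤
        K₀ * (|aeval ξ (P k)| * (G ^ n * polyHeight (P (k + 1)) ^ (2 * n - 2))) := by gcongr
    linarith
  · have h1 := hres (|aeval ξ Q| / polyHeight Q) ((div_le_iff₀ (by positivity)).1 hc)
      (by rw [div_mul_cancel₀ _ (by positivity)])
    have h2 : K₀ * (|aeval ξ Q| / polyHeight Q * (polyHeight (P k) ^ m * polyHeight Q ^ n)) =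
        K₀ * (|aeval ξ Q| * (polyHeight (P k) ^ m * polyHeight Q ^ n')) := by
      rw [hn', pow_succ']
      field_simp
    have h3 : (polyHeight (P k) : ℝ) ≤ polyHeight Q := by nlinarith
    calc (1 : ℝ) ≤ K₀ * (|aeval ξ Q| * (polyHeight (P k) ^ m * polyHeight Q ^ n')) := h2 ▸ h1
      _ ≤ K₀ * (|aeval ξ Q| * (polyHeight Q ^ m * polyHeight Q ^ n')) := by gcongr
      _ = K₀ * (|aeval ξ Q| * polyHeight Q ^ (m + n')) := by rw [pow_add]
      _ ≤ K₀ * (|aeval ξ Q| * polyHeight Q ^ (2 * n - 2)) := by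
        gcongr
        omega
      _ = _ := by ring

lemma exists_lower_bound (hP : IsBestApproxSeq n ξ P) (hξ : Transcendental ℚ ξ)
    (hsmall : ∀ M : ℝ, ∀ᶠ k in atTop,
      M * (|aeval ξ (P k)| * polyHeight (P (k + 1)) ^ (2 * n - 2)) < 1) (d : ℕ) (hd : d < n) :
    ∃ c > 0, ∀ R : ℤ[X], R ≠ 0 → R.natDegree ≤ d →
      c ≤ |aeval ξ R| * polyHeight R ^ (2 * n - 2) := by
  obtain ⟨G, hG1, hG⟩ := exists_polyHeight_mul_le n
  obtain ⟨c₁, hc₁, hirr⟩ := hP.exists_lower_bound_irreducible hξ hsmall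
  induction d with
  | zero =>
    refine ⟨1, one_pos, fun R hR0 hR => ?_⟩
    obtain ⟨r, rfl⟩ := natDegree_eq_zero.1 (Nat.le_zero.1 hR)
    have hr : r ≠ 0 := by rintro rfl; simp at hR0
    have h1 : (1 : ℝ) ≤ polyHeight (C r) := by exact_mod_cast one_le_polyHeight hR0
    have h2 : (1 : ℝ) ≤ |aeval ξ (C r)| := by
      rw [aeval_C, eq_intCast, ← Int.cast_abs]
      exact_mod_cast Int.one_le_abs hr
    exact one_le_mul_of_one_le_of_one_le h2 (one_le_pow₀ h1)
  | succ d ih =>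
    obtain ⟨c, hc, hle⟩ := ih (by omega)
    refine ⟨min c (min c₁ (c * c / G ^ (2 * n - 2))), by positivity, fun R hR0 hR => ?_⟩
    rcases Nat.eq_zero_or_pos R.natDegree with h0 | h0
    · exact (min_le_left _ _).trans (hle R hR0 (by omega))
    refine (min_le_right _ _).trans ?_
    rcases exists_mul_or_exists_C_mul_irreducible h0 with ⟨A, B, rfl, hA, hB⟩ | ⟨a, Q, ha, hQ, rfl⟩
    · exact (min_le_right _ _).trans (div_le_abs_aeval_mul (by positivity) hc.le
        (hG A B hR0 (by omega)) (hle A (left_ne_zero_of_mul hR0) (by omega))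
        (hle B (right_ne_zero_of_mul hR0) (by omega)))
    · rw [natDegree_C_mul ha] at h0 hR
      refine (min_le_left _ _).trans ((hirr Q hQ h0 (by omega)).trans ?_)
      have h1 : (1 : ℝ) ≤ |(a : ℝ)| := by
        rw [← Int.cast_abs]
        exact_mod_cast Int.one_le_abs ha
      have h2 : |aeval ξ Q| ≤ |aeval ξ (C a * Q)| := by
        rw [map_mul, aeval_C, eq_intCast, abs_mul]
        exact le_mul_of_one_le_left (abs_nonneg _) h1
      exact mul_le_mul h2 (by gcongr; exact polyHeight_le_C_mul ha Q) (by positivity)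
        (abs_nonneg _)

lemma eventually_irreducible (hP : IsBestApproxSeq n ξ P) (hn : 2 ≤ n) (hξ : Transcendental ℚ ξ)
    (hsmall : ∀ M : ℝ, ∀ᶠ k in atTop,
      M * (|aeval ξ (P k)| * polyHeight (P (k + 1)) ^ (2 * n - 2)) < 1) :
    ∀ᶠ k in atTop, Irreducible (ratPoly (P k)) ∧ (P k).natDegree = n := by
  obtain ⟨G, hG1, hG⟩ := exists_polyHeight_mul_le n
  obtain ⟨c, hc, hle⟩ := hP.exists_lower_bound hξ hsmall (n - 1) (by omega)
  have hcontra : ∀ c : ℝ, 0 < c → ∀ᶠ k in atTop,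
      |aeval ξ (P k)| * polyHeight (P k) ^ (2 * n - 2) < c := by
    intro c hc
    filter_upwards [hsmall c⁻¹, eventually_ge_atTop 1] with k hk hk1
    rw [inv_mul_lt_one₀ hc] at hk
    refine lt_of_le_of_lt ?_ hk
    gcongr
    exact (hP.height_lt k hk1).le
  filter_upwards [hcontra c hc, hcontra (c * c / G ^ (2 * n - 2)) (by positivity),
    eventually_ge_atTop 1] with k h1 h2 hk
  have hdeg : (P k).natDegree = n := by
    by_contra hne
    have := hP.deg_le k hk
    exact absurd (hle (P k) (hP.ne_zero k hk) (by omega)) (not_le.2 h1)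
  refine ⟨?_, hdeg⟩
  rcases exists_mul_or_exists_C_mul_irreducible (by omega : 0 < (P k).natDegree) with
    ⟨A, B, hAB, hA, hB⟩ | ⟨a, Q, ha, hQ, hPk⟩
  · exfalso
    have h0 : A * B ≠ 0 := hAB ▸ hP.ne_zero k hk
    have := div_le_abs_aeval_mul (ξ := ξ) (by positivity) hc.le (hG A B h0 (by rw [← hAB]; omega))
      (hle A (left_ne_zero_of_mul h0) (by omega)) (hle B (right_ne_zero_of_mul h0) (by omega))
    rw [← hAB] at this
    linarith
  · have hQdeg : Q.natDegree ≠ 0 := by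
      rw [hPk, natDegree_C_mul ha] at hdeg
      omega
    have hirr : Irreducible (ratPoly Q) :=
      (IsPrimitive.Int.irreducible_iff_irreducible_map_cast (hQ.isPrimitive hQdeg)).1 hQ
    have hu : IsUnit (C (a : ℚ)) := isUnit_C.2 (by simpa using ha)
    have heq : ratPoly (P k) = C (a : ℚ) * ratPoly Q := by
      rw [hPk]
      simp [ratPoly]
    rw [heq]
    exact (irreducible_isUnit_mul hu).2 hirr

end IsBestApproxSeq

/-! ### Growth of the heights -/

lemma sq_add_mul_le_of_mem_Icc {s T δ m r : ℝ} (h1 : δ ≤ s - m)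
    (hT : δ * T ≤ (s + 1) * T - m - T ^ 2) (hr1 : 1 ≤ r) (hrT : r ≤ T) :
    r ^ 2 + δ * r ≤ (s + 1) * r - m := by
  rcases le_total 0 (s - T - δ) with h | h
  · nlinarith [mul_nonneg (sub_nonneg.2 hr1) (sub_nonneg.2 hrT), mul_nonneg h (sub_nonneg.2 hr1)]
  · nlinarith [mul_nonneg (sub_nonneg.2 hr1) (sub_nonneg.2 hrT),
      mul_nonneg (neg_nonneg.2 h) (sub_nonneg.2 hrT)]

lemma not_eventually_recurrence_of_tendsto {h : ℕ → ℝ} {s m : ℝ} (hm : 0 ≤ m) (hs : m < s)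
    (hs2 : (m + 1) ^ 2 < s ^ 2 + (m + 1) * s) (hmono : ∀ᶠ k in atTop, h k ≤ h (k + 1))
    (hpos : ∀ᶠ k in atTop, 0 < h k)
    (hA : ∀ᶠ k in atTop, s * h (k + 1) ≤ (m + 1) * h k)
    (hB : ∀ᶠ k in atTop, (s + 1) * h (k + 1) - m * h k ≤ h (k + 2)) : False := by
  obtain ⟨K, hK⟩ := eventually_atTop.1 (hmono.and (hpos.and (hA.and hB)))
  have hs0 : 0 < s := hm.trans_lt hs
  set T := (m + 1) / s with hTdef
  have hT0 : 0 < T := by positivity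
  have hTs : T * s = m + 1 := by rw [hTdef]; field_simp
  have hgap : 0 < (s + 1) * T - m - T ^ 2 := by
    have : 0 < ((s + 1) * T - m - T ^ 2) * s ^ 2 := by
      have : ((s + 1) * T - m - T ^ 2) * s ^ 2 =
          (s + 1) * s * (T * s) - m * s ^ 2 - (T * s) ^ 2 := by ring
      rw [this, hTs]
      linarith
    exact pos_of_mul_pos_left this (by positivity)
  obtain ⟨δ, hδ0, hδ1, hδT⟩ : ∃ δ > 0, δ ≤ s - m ∧ δ * T ≤ (s + 1) * T - m - T ^ 2 :=
    ⟨min (s - m) (((s + 1) * T - m - T ^ 2) / T), lt_min (by linarith) (by positivity),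
      min_le_left _ _, (le_div_iff₀ hT0).1 (min_le_right _ _)⟩
  have hr : ∀ k ≥ K, 1 ≤ h (k + 1) / h k ∧ h (k + 1) / h k ≤ T := by
    intro k hk
    obtain ⟨h1, h2, h3, -⟩ := hK k hk
    refine ⟨(one_le_div h2).2 h1, ?_⟩
    rw [hTdef, div_le_div_iff₀ h2 hs0]
    linarith
  have hstep : ∀ k ≥ K, h (k + 1) / h k + δ ≤ h (k + 2) / h (k + 1) := by
    intro k hk
    obtain ⟨-, h2, -, h4⟩ := hK k hk
    obtain ⟨-, h2', -, -⟩ := hK (k + 1) (by omega)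
    have h5 := sq_add_mul_le_of_mem_Icc hδ1 hδT (hr k hk).1 (hr k hk).2
    have h6 : (h (k + 1) / h k) * h k = h (k + 1) := div_mul_cancel₀ _ h2.ne'
    set r := h (k + 1) / h k
    rw [le_div_iff₀ h2']
    calc (r + δ) * h (k + 1) = (r ^ 2 + δ * r) * h k := by rw [← h6]; ring
      _ ≤ ((s + 1) * r - m) * h k := by gcongr
      _ = (s + 1) * h (k + 1) - m * h k := by rw [← h6]; ring
      _ ≤ _ := h4
  have hind : ∀ j : ℕ, j * δ ≤ h (K + j + 1) / h (K + j) := by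
    intro j
    induction j with
    | zero => simpa using zero_le_one.trans (hr K le_rfl).1
    | succ j ih =>
      have := hstep (K + j) (by omega)
      push_cast
      rw [show K + (j + 1) + 1 = K + j + 2 by ring, show K + (j + 1) = K + j + 1 by ring]
      linarith
  obtain ⟨j, hj⟩ := exists_nat_gt (T / δ)
  have h1 := (hind j).trans (hr (K + j) (by omega)).2
  rw [div_lt_iff₀ hδ0] at hj
  linarith

lemma not_eventually_recurrence_add_const {h : ℕ → ℝ} {s m c : ℝ} (hm : 0 ≤ m) (hs : m < s)
    (hs2 : (m + 1) ^ 2 < s ^ 2 + (m + 1) * s) (hmono : ∀ᶠ k in atTop, h k ≤ h (k + 1))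
    (htop : Tendsto h atTop atTop)
    (hA : ∀ᶠ k in atTop, s * h (k + 1) ≤ (m + 1) * h k + c)
    (hB : ∀ᶠ k in atTop, (s + 1) * h (k + 1) - m * h k ≤ h (k + 2) + c) : False := by
  obtain ⟨s', hs's, hms', hs2'⟩ : ∃ s' < s, m < s' ∧ (m + 1) ^ 2 < s' ^ 2 + (m + 1) * s' := by
    have h1 : ∀ᶠ t in nhds s, m < t := eventually_gt_nhds hs
    have h2 : ∀ᶠ t in nhds s, (m + 1) ^ 2 < t ^ 2 + (m + 1) * t :=
      ((by fun_prop : Continuous fun t : ℝ => t ^ 2 + (m + 1) * t).tendsto s).eventually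
        (eventually_gt_nhds hs2)
    obtain ⟨t, ht, ht'⟩ := (((h1.and h2).filter_mono nhdsWithin_le_nhds).and
      (self_mem_nhdsWithin : Set.Iio s ∈ nhdsWithin s (Set.Iio s))).exists
    exact ⟨t, ht', ht⟩
  have hc : ∀ᶠ k in atTop, c ≤ (s - s') * h (k + 1) := by
    have := (htop.comp (tendsto_add_atTop_nat 1)).const_mul_atTop (sub_pos.2 hs's)
    exact this.eventually_ge_atTop c
  refine not_eventually_recurrence_of_tendsto hm hms' hs2' hmono
    (htop.eventually_gt_atTop 0) ?_ ?_
  · filter_upwards [hA, hc] with k h1 h2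
    linarith
  · filter_upwards [hB, hc] with k h1 h2
    linarith

/-! ### The bound for the uniform exponent -/

lemma not_dvd_of_linearIndependent {p q r : ℚ[X]} (hli : LinearIndependent ℚ ![p, q, r])
    (hdeg : p.natDegree = q.natDegree) : ¬ q ∣ p := by
  rintro ⟨S, hS⟩
  have hp : p ≠ 0 := hli.ne_zero 0
  have hq0 : q ≠ 0 := hli.ne_zero 1
  have hS0 : S ≠ 0 := by rintro rfl; exact hp (by simpa using hS)
  have hSdeg : S.natDegree = 0 := by
    have := natDegree_mul hq0 hS0
    rw [← hS] at this
    omega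
  obtain ⟨s, rfl⟩ := natDegree_eq_zero.1 hSdeg
  have h0 := Fintype.linearIndependent_iff.1 hli ![-1, s, 0] (by
    rw [Fin.sum_univ_three]
    simp only [Matrix.cons_val, smul_eq_C_mul]
    rw [hS]
    simp [mul_comm]) 0
  simp at h0

namespace IsBestApproxSeq

variable {n : ℕ} {ξ : ℝ} {P : ℕ → ℤ[X]}

lemma tendsto_height (hP : IsBestApproxSeq n ξ P) :
    Tendsto (fun k => (polyHeight (P k) : ℝ)) atTop atTop :=
  tendsto_natCast_atTop_atTop.comp
    ((tendsto_add_atTop_iff_nat 1).1 hP.height_strictMono.tendsto_atTop)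

lemma tendsto_log_height (hP : IsBestApproxSeq n ξ P) :
    Tendsto (fun k => Real.log (polyHeight (P k))) atTop atTop :=
  Real.tendsto_log_atTop.comp hP.tendsto_height

lemma eventually_log_le (hP : IsBestApproxSeq n ξ P) (hξ : Transcendental ℚ ξ) {w : ℝ}
    (hw : w ∈ uniformExpSet n ξ) :
    ∀ᶠ k in atTop, Real.log |aeval ξ (P k)| + w * Real.log (polyHeight (P (k + 1))) ≤
      w * Real.log 2 := by
  have htop : Tendsto (fun k => (polyHeight (P (k + 1)) : ℝ) / 2) atTop atTop :=
    (hP.tendsto_height.comp (tendsto_add_atTop_nat 1)).atTop_div_const (by norm_num)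
  filter_upwards [htop.eventually hw, eventually_ge_atTop 1] with k hk hk1
  obtain ⟨Q, hQn, hQX, hQ0, hQw⟩ := hk
  have hH : (0 : ℝ) < polyHeight (P (k + 1)) := by
    exact_mod_cast one_le_polyHeight (hP.ne_zero (k + 1) (by omega))
  have hlt : polyHeight Q < polyHeight (P (k + 1)) := by
    have : (polyHeight Q : ℝ) < polyHeight (P (k + 1)) := by linarith
    exact_mod_cast this
  have hle := hP.abs_aeval_le_of_height_lt (by rintro rfl; simp at hQ0) hQn hlt
  have hpos : 0 < |aeval ξ (P k)| :=
    abs_pos.2 (aeval_ne_zero_of_transcendental hξ (hP.ne_zero k hk1))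
  have hlog := Real.log_le_log hpos (hle.trans hQw.le)
  rw [Real.log_rpow (by positivity), Real.log_div hH.ne' (by norm_num)] at hlog
  linarith

lemma eventually_small (hP : IsBestApproxSeq n ξ P) (hξ : Transcendental ℚ ξ) (hn : 1 ≤ n) {w : ℝ}
    (hw : w ∈ uniformExpSet n ξ) (hlt : 2 * (n : ℝ) - 2 < w) (M : ℝ) :
    ∀ᶠ k in atTop, M * (|aeval ξ (P k)| * polyHeight (P (k + 1)) ^ (2 * n - 2)) < 1 := by
  have htop := ((hP.tendsto_log_height.comp (tendsto_add_atTop_nat 1)).const_mul_atTop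
    (sub_pos.2 hlt)).eventually_gt_atTop (Real.log (max M 1) + w * Real.log 2)
  filter_upwards [htop, hP.eventually_log_le hξ hw, eventually_ge_atTop 1] with k h1 h2 hk
  have hpos : 0 < |aeval ξ (P k)| :=
    abs_pos.2 (aeval_ne_zero_of_transcendental hξ (hP.ne_zero k hk))
  have hH : (0 : ℝ) < polyHeight (P (k + 1)) := by
    exact_mod_cast one_le_polyHeight (hP.ne_zero (k + 1) (by omega))
  have hM : 0 < max M 1 := lt_max_of_lt_right one_pos
  calc M * (|aeval ξ (P k)| * polyHeight (P (k + 1)) ^ (2 * n - 2))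
      ≤ max M 1 * (|aeval ξ (P k)| * polyHeight (P (k + 1)) ^ (2 * n - 2)) := by
        gcongr
        exact le_max_left _ _
    _ < 1 := by
        rw [← Real.log_neg_iff (by positivity), Real.log_mul hM.ne' (by positivity),
          Real.log_mul hpos.ne' (by positivity), Real.log_pow, Nat.cast_sub (by omega)]
        simp only [Function.comp_apply] at h1
        push_cast
        linarith

lemma le_of_mem_uniformExpSet (hP : IsBestApproxSeq n ξ P) (hn : 2 ≤ n) (hξ : Transcendental ℚ ξ)
    (hgood : ∀ᶠ k in atTop, Good P k) {w : ℝ} (hw : w ∈ uniformExpSet n ξ) :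
    w ≤ max (((√5 + 1) / 2) * (n : ℝ) - (√5 - 1) / 2) (2 * (n : ℝ) - 2) := by
  by_contra! hlt
  obtain ⟨hlt1, hlt2⟩ := max_lt_iff.1 hlt
  have hirr := hP.eventually_irreducible hn hξ (hP.eventually_small hξ (by omega) hw hlt2)
  obtain ⟨m, rfl⟩ := Nat.exists_eq_add_of_le' hn
  push_cast at hlt1 hlt2
  have hm0 : (0 : ℝ) ≤ m := Nat.cast_nonneg m
  have h5 : √5 ^ 2 = 5 := Real.sq_sqrt (by norm_num)
  have h5' : 1 < √5 := by rw [Real.lt_sqrt] <;> norm_num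
  obtain ⟨K₁, hK₁⟩ : ∃ K : ℝ,
      K = ((2 * (m + 2)).factorial : ℝ) * max 1 |ξ| ^ (2 * (m + 2)) := ⟨_, rfl⟩
  obtain ⟨K₂, hK₂⟩ : ∃ K : ℝ, K = ((2 * m + 3).factorial : ℝ) * max 1 |ξ| ^ m := ⟨_, rfl⟩
  have hK₁0 : 0 < K₁ := by rw [hK₁]; positivity
  have hK₂0 : 0 < K₂ := by rw [hK₂]; positivity
  have hbasic : ∀ᶠ k in atTop,
      Real.log |aeval ξ (P k)| + w * Real.log (polyHeight (P (k + 1))) ≤ w * Real.log 2 ∧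
      0 < |aeval ξ (P k)| ∧ (0 : ℝ) < polyHeight (P k) ∧
      (polyHeight (P k) : ℝ) ≤ polyHeight (P (k + 1)) ∧
      |aeval ξ (P (k + 1))| ≤ |aeval ξ (P k)| ∧
      Irreducible (ratPoly (P k)) ∧ (P k).natDegree = m + 2 := by
    filter_upwards [hP.eventually_log_le hξ hw, hirr, eventually_ge_atTop 1] with k h1 h2 hk
    exact ⟨h1, abs_pos.2 (aeval_ne_zero_of_transcendental hξ (hP.ne_zero k hk)),
      by exact_mod_cast one_le_polyHeight (hP.ne_zero k hk),
      by exact_mod_cast (hP.height_lt k hk).le, (hP.eval_lt k hk).le, h2⟩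
  have hshift : ∀ {p : ℕ → Prop}, (∀ᶠ k in atTop, p k) → ∀ᶠ k in atTop, p (k + 1) :=
    fun hp => (tendsto_add_atTop_nat 1).eventually hp
  have hsmall : ∀ {a b c d : ℝ}, 0 < b → b ≤ d → 0 ≤ a → c ≤ a → c ≤ a / b * d := by
    intro a b c d hb hbd ha hca
    rw [div_mul_eq_mul_div, le_div_iff₀ hb]
    exact mul_le_mul hca hbd hb.le ha
  refine not_eventually_recurrence_add_const (h := fun k => Real.log (polyHeight (P k)))
    (s := w - (m + 2)) (m := m) (c := max (Real.log K₁) (Real.log K₂) + w * Real.log 2)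
    hm0 (by linarith) ?_ ?_ hP.tendsto_log_height ?_ ?_
  · have hs : (√5 - 1) / 2 * ((m : ℝ) + 1) < w - (m + 2) := by linarith
    have hg : 0 < (√5 - 1) / 2 * ((m : ℝ) + 1) := by
      have : 0 < √5 - 1 := by linarith
      positivity
    have heq : ((m : ℝ) + 1) ^ 2 = ((√5 - 1) / 2 * ((m : ℝ) + 1)) ^ 2 +
        (m + 1) * ((√5 - 1) / 2 * ((m : ℝ) + 1)) := by
      linear_combination (-(1 / 4) * ((m : ℝ) + 1) ^ 2) * h5
    rw [heq]
    gcongr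
  · filter_upwards [hbasic] with k ⟨_, _, h3, h4, _⟩
    exact Real.log_le_log h3 h4
  · filter_upwards [hbasic, hshift hbasic, hshift hgood] with k
      ⟨h1, hp, hH, hHH, hv, hirrk, hdeg⟩ ⟨_, _, hH', _, _, hirrk', hdeg'⟩ hg
    have hg' : LinearIndependent ℚ
        ![ratPoly (P k), ratPoly (P (k + 1)), ratPoly (P (k + 1 + 1))] := hg
    have hres := one_le_mul_of_irreducible_of_not_dvd ξ hirrk'
      (not_dvd_of_linearIndependent hg' (by simp only [natDegree_ratPoly, hdeg, hdeg']))
      hdeg.le hdeg' (N := 2 * (m + 2)) (by omega) (ε := |aeval ξ (P k)| / polyHeight (P k))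
      (hsmall hH le_rfl hp.le le_rfl) (hsmall hH hHH hp.le hv)
    have hlog := Real.log_le_log one_pos hres
    rw [← hK₁, Real.log_one, Real.log_mul hK₁0.ne' (by positivity),
      Real.log_mul (by positivity) (by positivity), Real.log_div hp.ne' hH.ne',
      Real.log_mul (by positivity) (by positivity), Real.log_pow, Real.log_pow] at hlog
    push_cast at hlog
    have := le_max_left (Real.log K₁) (Real.log K₂)
    linarith
  · filter_upwards [hbasic, hshift hbasic, hshift (hshift hbasic), hshift hgood] with k
      ⟨h1, hp, hH, hHH, hv, hirrk, hdeg⟩ ⟨_, _, hH', hHH', hv', hirrk', hdeg'⟩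
      ⟨_, _, hH'', _, _, _, hdeg''⟩ hg
    have hg' : LinearIndependent ℚ
        ![ratPoly (P k), ratPoly (P (k + 1)), ratPoly (P (k + 1 + 1))] := hg
    have hres := one_le_mul_of_linearIndependent_three ξ hirrk'
      (not_dvd_of_linearIndependent hg' (by simp only [natDegree_ratPoly, hdeg, hdeg']))
      hdeg.le hdeg' hdeg''.le hg' (ε := |aeval ξ (P k)| / polyHeight (P k))
      (hsmall hH le_rfl hp.le le_rfl) (hsmall hH hHH hp.le hv)
      (hsmall hH (hHH.trans hHH') hp.le (hv'.trans hv))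
    have hlog := Real.log_le_log one_pos hres
    rw [← hK₂, Real.log_one, Real.log_mul hK₂0.ne' (by positivity),
      Real.log_mul (by positivity) (by positivity), Real.log_div hp.ne' hH.ne',
      Real.log_mul (by positivity) (by positivity), Real.log_mul (by positivity) (by positivity),
      Real.log_pow, Real.log_pow] at hlog
    push_cast at hlog
    have := le_max_right (Real.log K₁) (Real.log K₂)
    linarith

end IsBestApproxSeq

/-- conditional bound `ŵ_n(ξ) ≤ ρ_n` assuming all sufficiently large `k`
are good. -/
theorem stmt2 (n : ℕ) (hn : 2 ≤ n) (ξ : ℝ) (hξ : Transcendental ℚ ξ)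
    (P : ℕ → Polynomial ℤ) (hP : IsBestApproxSeq n ξ P)
    (hgood : ∀ᶠ k in Filter.atTop, Good P k) :
    wHat n ξ ≤
      ((max (((Real.sqrt 5 + 1)/2)*(n:ℝ) - (Real.sqrt 5 - 1)/2) (2*(n:ℝ)-2) : ℝ) : EReal)
    ∧ (4 ≤ n → wHat n ξ ≤ ((2*(n:ℝ)-2 : ℝ) : EReal))
    ∧ (n = 3 → wHat n ξ ≤ ((2 + Real.sqrt 5 : ℝ) : EReal))
    ∧ (n = 2 → wHat n ξ ≤ (((3 + Real.sqrt 5)/2 : ℝ) : EReal)) := by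
  have hmain : ∀ ρ : ℝ, max (((Real.sqrt 5 + 1)/2)*(n:ℝ) - (Real.sqrt 5 - 1)/2) (2*(n:ℝ)-2) ≤ ρ →
      wHat n ξ ≤ (ρ : EReal) := by
    intro ρ hρ
    refine sSup_le ?_
    rintro _ ⟨w, hw, rfl⟩
    exact EReal.coe_le_coe_iff.2 ((hP.le_of_mem_uniformExpSet hn hξ hgood hw).trans hρ)
  have h5 : √5 ^ 2 = 5 := Real.sq_sqrt (by norm_num)
  have h5' : 2 ≤ √5 := Real.le_sqrt_of_sq_le (by norm_num)
  have h5'' : √5 ≤ 7 / 3 := (Real.sqrt_le_left (by norm_num)).2 (by norm_num)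
  refine ⟨hmain _ le_rfl, fun h4 => hmain _ (max_le ?_ le_rfl), ?_, ?_⟩
  · have h4' : (4 : ℝ) ≤ n := by exact_mod_cast h4
    nlinarith
  · rintro rfl
    refine hmain _ (max_le ?_ ?_) <;> push_cast <;> linarith
  · rintro rfl
    refine hmain _ (max_le ?_ ?_) <;> push_cast <;> linarith
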